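/- For arbitrary α > 0, C_H(A, αA) ≤ (nr/2)·log(1 + (1/nr)·max_{P_X} tr(Cov(HX))), where the maximization is over all input distributions P_X satisfying the peak- and average-power constraints. -/

import Mathlib

open MeasureTheory ProbabilityTheory Matrix Filter Topology
open scoped ENNReal NNReal BigOperators

noncomputable section

namespace MimoOptical

variable {nt nr : ℕ}

/-- The law of a standard Gaussian vector `Z ~ N(0, I_n)` on `ℝ^n`. -/
def stdGaussian (n : ℕ) : Measure (Fin n → ℝ) :=
  Measure.pi fun _ => gaussianReal 0 1

/-- Real-valued Kullback–Leibler divergence `∫ log (dμ/dν) dμ`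
(with junk value if not absolutely continuous or not integrable). -/
def klDivR {Ω : Type*} [MeasurableSpace Ω] (μ ν : Measure Ω) : ℝ :=
  ∫ ω, Real.log (μ.rnDeriv ν ω).toReal ∂μ

/-- Mutual information of a joint law on a product space: the KL divergence between
the joint law and the product of its marginals. -/
def mutualInfoJoint {β γ : Type*} [MeasurableSpace β] [MeasurableSpace γ]
    (π : Measure (β × γ)) : ℝ :=
  klDivR π ((π.map Prod.fst).prod (π.map Prod.snd))

/-- Joint law of `(X, H X + Z)` where `X ~ μ` and `Z ~ N(0, I_nr)` is independent of `X`. -/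
def jointLaw (H : Matrix (Fin nr) (Fin nt) ℝ) (μ : Measure (Fin nt → ℝ)) :
    Measure ((Fin nt → ℝ) × (Fin nr → ℝ)) :=
  (μ.prod (stdGaussian nr)).map (fun p => (p.1, H.mulVec p.1 + p.2))

/-- An admissible input distribution: a probability measure on `[0, A]^nt`
with average power `E[‖X‖₁] ≤ avg`. -/
def Admissible (nt : ℕ) (A avg : ℝ) (μ : Measure (Fin nt → ℝ)) : Prop :=
  IsProbabilityMeasure μ ∧ (∀ᵐ x ∂μ, ∀ k, x k ∈ Set.Icc (0 : ℝ) A) ∧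
    (∫ x, ∑ k, |x k| ∂μ) ≤ avg

/-- Capacity of the MIMO optical intensity channel with peak power `A` and
average power `avg`. -/
def capacity (H : Matrix (Fin nr) (Fin nt) ℝ) (A avg : ℝ) : ℝ :=
  sSup { c | ∃ μ : Measure (Fin nt → ℝ),
    Admissible nt A avg μ ∧ c = mutualInfoJoint (jointLaw H μ) }

/-- The zonotope `R(M) = { M λ : λ ∈ [0,A]^k }`. -/
def zonotope {n k : ℕ} (M : Matrix (Fin n) (Fin k) ℝ) (A : ℝ) : Set (Fin n → ℝ) :=
  { x | ∃ lam : Fin k → ℝ, (∀ i, lam i ∈ Set.Icc 0 A) ∧ x = M.mulVec lam }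

/-- The collection `𝒰` of `nr`-element subsets of columns that are linearly independent. -/
def goodSets (H : Matrix (Fin nr) (Fin nt) ℝ) : Set (Finset (Fin nt)) :=
  { U | U.card = nr ∧ LinearIndependent ℝ (fun j : {x // x ∈ U} => fun i => H i j.1) }

/-- The square matrix `H_U` whose columns are the columns of `H` indexed by `U`
(junk value, the identity, if `U.card ≠ nr`). -/
def HU (H : Matrix (Fin nr) (Fin nt) ℝ) (U : Finset (Fin nt)) :
    Matrix (Fin nr) (Fin nr) ℝ :=
  if h : U.card = nr then H.submatrix id (fun i => U.orderEmbOfFin h i) else 1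

/-- `a_{U,j} = 1ᵀ H_U⁻¹ h_j`. -/
def aUj (H : Matrix (Fin nr) (Fin nt) ℝ) (U : Finset (Fin nt)) (j : Fin nt) : ℝ :=
  ∑ i, ((HU H U)⁻¹).mulVec (fun r => H r j) i

/-- `g_{U,j} = 1` if `a_{U,j} > 1` and `0` otherwise. -/
def gUj (H : Matrix (Fin nr) (Fin nt) ℝ) (U : Finset (Fin nt)) (j : Fin nt) : ℝ :=
  if 1 < aUj H U j then 1 else 0

/-- `s_U = Σ_{j ∈ Uᶜ} g_{U,j}`. -/
def sU (H : Matrix (Fin nr) (Fin nt) ℝ) (U : Finset (Fin nt)) : ℝ :=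
  ∑ j ∈ Uᶜ, gUj H U j

/-- `v_U = A Σ_{j ∈ Uᶜ} g_{U,j} h_j`. -/
def vU (H : Matrix (Fin nr) (Fin nt) ℝ) (A : ℝ) (U : Finset (Fin nt)) : Fin nr → ℝ :=
  fun r => A * ∑ j ∈ Uᶜ, gUj H U j * H r j

/-- The parallelepiped `D_U = R(H_U)`. -/
def DU (H : Matrix (Fin nr) (Fin nt) ℝ) (A : ℝ) (U : Finset (Fin nt)) :
    Set (Fin nr → ℝ) :=
  zonotope (HU H U) A

/-- The shifted parallelepiped `v_U + D_U`. -/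
def cell (H : Matrix (Fin nr) (Fin nt) ℝ) (A : ℝ) (U : Finset (Fin nt)) :
    Set (Fin nr → ℝ) :=
  (fun d => vU H A U + d) '' DU H A U

/-- `V_H = Σ_{U ∈ 𝒰} |det H_U|`. -/
def VH (H : Matrix (Fin nr) (Fin nt) ℝ) : ℝ :=
  ∑ᶠ U ∈ goodSets H, |(HU H U).det|

/-- `q_U = |det H_U| / V_H`. -/
def qU (H : Matrix (Fin nr) (Fin nt) ℝ) (U : Finset (Fin nt)) : ℝ :=
  |(HU H U).det| / VH H

/-- `α_th = nr/2 + Σ_{U ∈ 𝒰} s_U q_U`. -/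
def alphaTh (H : Matrix (Fin nr) (Fin nt) ℝ) : ℝ :=
  (nr : ℝ) / 2 + ∑ᶠ U ∈ goodSets H, sU H U * qU H U

/-- A probability vector on `𝒰`. -/
def ProbVec (H : Matrix (Fin nr) (Fin nt) ℝ) (p : Finset (Fin nt) → ℝ) : Prop :=
  (∀ U, 0 ≤ p U) ∧ (∀ U, U ∉ goodSets H → p U = 0) ∧ (∑ᶠ U ∈ goodSets H, p U) = 1

/-- Kullback–Leibler divergence `D(p‖q)` between probability vectors on `𝒰`. -/
def Dkl (H : Matrix (Fin nr) (Fin nt) ℝ) (p q : Finset (Fin nt) → ℝ) : ℝ :=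
  ∑ᶠ U ∈ goodSets H, p U * Real.log (p U / q U)

/-- `σ_{U,ℓ}`: square root of the `ℓ`-th diagonal entry of `H_U⁻¹ (H_U⁻¹)ᵀ`. -/
def sigmaUl (H : Matrix (Fin nr) (Fin nt) ℝ) (U : Finset (Fin nt)) (ℓ : Fin nr) : ℝ :=
  Real.sqrt ((((HU H U)⁻¹) * ((HU H U)⁻¹)ᵀ) ℓ ℓ)

/-- The trace of the covariance matrix of `X̄ = H X` when `X ~ μ`. -/
def traceCov (H : Matrix (Fin nr) (Fin nt) ℝ) (μ : Measure (Fin nt → ℝ)) : ℝ :=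
  ∑ i, ((∫ x, (H.mulVec x i) ^ 2 ∂μ) - (∫ x, H.mulVec x i ∂μ) ^ 2)

/-- The Gaussian Q-function. -/
def Qf (x : ℝ) : ℝ :=
  ∫ t in Set.Ioi x, Real.exp (-t ^ 2 / 2) / Real.sqrt (2 * Real.pi)

/-- The high-SNR penalty `ν` due to the average-power constraint. -/
def nuVal (H : Matrix (Fin nr) (Fin nt) ℝ) (α : ℝ) : ℝ :=
  sSup { y | ∃ lam mu : ℝ,
    lam ∈ Set.Ioo (max 0 ((nr : ℝ) / 2 + α - alphaTh H)) (min ((nr : ℝ) / 2) α) ∧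
    0 < mu ∧
    1 / mu - Real.exp (-mu) / (1 - Real.exp (-mu)) = lam / (nr : ℝ) ∧
    y = (nr : ℝ) * (1 - Real.log (mu / (1 - Real.exp (-mu)))
          - mu * Real.exp (-mu) / (1 - Real.exp (-mu)))
        - sInf { d | ∃ p : Finset (Fin nt) → ℝ, ProbVec H p ∧
            (∑ᶠ U ∈ goodSets H, p U * sU H U) = α - lam ∧ d = Dkl H p (qU H) } }

/-- Gibbs-type bound on the mutual information of a joint law with a density. -/
lemma mutualInfo_le_aux {β γ : Type*} [MeasurableSpace β] [MeasurableSpace γ]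
    (μ : Measure β) [IsProbabilityMeasure μ] (lam : Measure γ) [SigmaFinite lam]
    (f : β × γ → ℝ≥0∞) (hf : Measurable f) (hf0 : ∀ p, f p ≠ 0) (hft : ∀ p, f p ≠ ∞)
    (π : Measure (β × γ)) [IsProbabilityMeasure π] (hπ : π = (μ.prod lam).withDensity f)
    (h1 : π.map Prod.fst = μ)
    (h : γ → ℝ≥0∞) (hh : Measurable h) (hh0 : ∀ y, h y ≠ 0) (hht : ∀ y, h y ≠ ∞)
    (hh1 : ∫⁻ y, h y ∂lam ≤ 1)
    (hLogInt : Integrable (fun p => Real.log ((f p).toReal / (h p.2).toReal)) π)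
    (hnn : 0 ≤ ∫ p, Real.log ((f p).toReal / (h p.2).toReal) ∂π) :
    mutualInfoJoint π ≤ ∫ p, Real.log ((f p).toReal / (h p.2).toReal) ∂π := by
  set fY : γ → ℝ≥0∞ := fun y => ∫⁻ x, f (x, y) ∂μ with hfY
  have hfYm : Measurable fY := hf.lintegral_prod_left'
  have h2 : π.map Prod.snd = lam.withDensity fY := by
    refine Measure.ext_of_lintegral _ fun g hg => ?_
    rw [lintegral_map hg measurable_snd, hπ,
      lintegral_withDensity_eq_lintegral_mul _ hf (g := fun p => g p.2) (by fun_prop),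
      lintegral_withDensity_eq_lintegral_mul _ hfYm hg,
      lintegral_prod_symm _ (by fun_prop)]
    refine lintegral_congr fun y => ?_
    simp only [Pi.mul_apply]
    rw [lintegral_mul_const _ (by fun_prop)]
  have hfY0 : ∀ y, fY y ≠ 0 := by
    intro y hy
    rw [hfY] at hy
    rw [lintegral_eq_zero_iff (by fun_prop)] at hy
    have : ∀ᵐ x ∂μ, False := by
      filter_upwards [hy] with x hx using hf0 _ hx
    rw [Filter.eventually_false_iff_eq_bot, ae_eq_bot] at this
    exact IsProbabilityMeasure.ne_zero μ this
  have hPY : IsProbabilityMeasure (lam.withDensity fY) := by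
    rw [← h2]; exact Measure.isProbabilityMeasure_map (by fun_prop)
  have hfYt : ∀ᵐ y ∂lam, fY y < ∞ := by
    refine ae_lt_top hfYm ?_
    have := hPY.measure_univ
    rw [withDensity_apply _ MeasurableSet.univ, Measure.restrict_univ] at this
    rw [this]; simp
  have hfYt' : ∀ᵐ p ∂(μ.prod lam), fY p.2 < ∞ :=
    Measure.quasiMeasurePreserving_snd.ae hfYt
  have hprod : μ.prod (lam.withDensity fY) = (μ.prod lam).withDensity (fun p => fY p.2) :=
    prod_withDensity_right hfYm
  have hπ2 : π = (μ.prod (lam.withDensity fY)).withDensity (fun p => f p / fY p.2) := by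
    rw [hprod, ← withDensity_mul _ (by fun_prop) (by fun_prop), hπ]
    refine withDensity_congr_ae ?_
    filter_upwards [hfYt'] with p hp
    simp only [Pi.mul_apply]
    rw [ENNReal.mul_div_cancel (hfY0 _) hp.ne]
  have hac : π ≪ μ.prod (lam.withDensity fY) := by
    rw [hπ2]; exact withDensity_absolutelyContinuous _ _
  have hrn : π.rnDeriv (μ.prod (lam.withDensity fY)) =ᵐ[π] fun p => f p / fY p.2 := by
    refine hac.ae_le ?_
    have := Measure.rnDeriv_withDensity (μ.prod (lam.withDensity fY))
      (f := fun p => f p / fY p.2) (by fun_prop)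
    rwa [← hπ2] at this
  have hπt : ∀ᵐ p ∂π, fY p.2 < ∞ := by
    rw [hπ]; exact (withDensity_absolutelyContinuous _ _).ae_le hfYt'
  have hl : ∫⁻ p, h p.2 / fY p.2 ∂π ≤ 1 := by
    have : ∫⁻ p, h p.2 / fY p.2 ∂π = ∫⁻ y, h y / fY y ∂(π.map Prod.snd) := by
      rw [lintegral_map (by fun_prop) measurable_snd]
    rw [this, h2, lintegral_withDensity_eq_lintegral_mul _ hfYm (by fun_prop)]
    refine le_trans (lintegral_mono fun y => ?_) hh1
    simp only [Pi.mul_apply]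
    exact ENNReal.mul_div_le
  have hli : Integrable (fun p => (h p.2 / fY p.2).toReal) π :=
    integrable_toReal_of_lintegral_ne_top (by fun_prop) (ne_top_of_le_ne_top (by simp) hl)
  have hli1 : ∫ p, (h p.2 / fY p.2).toReal ∂π ≤ 1 := by
    rw [integral_toReal (by fun_prop)]
    · exact ENNReal.toReal_le_of_le_ofReal zero_le_one (by simpa using hl)
    · exact ae_lt_top (by fun_prop) (ne_top_of_le_ne_top (by simp) hl)
  unfold mutualInfoJoint klDivR
  rw [h1, h2]
  by_cases hI : Integrable (fun ω => Real.log
      (π.rnDeriv (μ.prod (lam.withDensity fY)) ω).toReal) π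
  swap
  · rw [integral_undef hI]; exact hnn
  calc _ ≤ ∫ p, (Real.log ((f p).toReal / (h p.2).toReal)
          + ((h p.2 / fY p.2).toReal - 1)) ∂π := by
        refine integral_mono_ae hI (hLogInt.add (hli.sub (integrable_const 1))) ?_
        filter_upwards [hrn, hπt] with p hp hpt
        simp only [hp]
        have a : 0 < (f p).toReal := ENNReal.toReal_pos (hf0 _) (hft _)
        have b : 0 < (fY p.2).toReal := ENNReal.toReal_pos (hfY0 _) hpt.ne
        have c : 0 < (h p.2).toReal := ENNReal.toReal_pos (hh0 _) (hht _)
        rw [ENNReal.toReal_div, ENNReal.toReal_div, Real.log_div a.ne' b.ne',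
          Real.log_div a.ne' c.ne']
        have := Real.log_le_sub_one_of_pos (div_pos c b)
        rw [Real.log_div c.ne' b.ne'] at this
        linarith
    _ ≤ _ := by
        rw [integral_add hLogInt (g := fun p => (h p.2 / fY p.2).toReal - 1)
            (hli.sub (integrable_const 1)),
          integral_sub hli (integrable_const 1)]
        simp only [integral_const, probReal_univ, smul_eq_mul, mul_one]
        linarith

/-- Gaussian product density. -/
def gd {n : ℕ} (m : Fin n → ℝ) (v : ℝ≥0) (y : Fin n → ℝ) : ℝ :=
  ∏ i, gaussianPDFReal (m i) v (y i)

lemma gd_pos {n : ℕ} (m : Fin n → ℝ) {v : ℝ≥0} (hv : v ≠ 0) (y : Fin n → ℝ) : 0 < gd m v y :=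
  Finset.prod_pos fun _ _ => gaussianPDFReal_pos _ _ _ hv

lemma measurable_gd {n : ℕ} (m : Fin n → ℝ) (v : ℝ≥0) : Measurable (gd m v) := by
  unfold gd
  exact Finset.measurable_prod _ fun i _ =>
    (measurable_gaussianPDFReal _ _).comp (measurable_pi_apply i)

lemma pi_gaussian_eq {n : ℕ} (m : Fin n → ℝ) {v : ℝ≥0} (hv : v ≠ 0) :
    Measure.pi (fun i => gaussianReal (m i) v)
      = (volume : Measure (Fin n → ℝ)).withDensity (fun y => ENNReal.ofReal (gd m v y)) := by
  refine Measure.pi_eq fun s hs => ?_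
  rw [withDensity_apply _ (MeasurableSet.univ_pi hs), volume_pi, Measure.restrict_pi_pi,
    ← ofReal_integral_eq_lintegral_ofReal]
  · unfold gd
    rw [integral_fintype_prod_eq_prod (f := fun i t => gaussianPDFReal (m i) v t),
      ENNReal.ofReal_prod_of_nonneg]
    · refine Finset.prod_congr rfl fun i _ => ?_
      rw [gaussianReal_apply_eq_integral _ hv]
    · exact fun i _ => integral_nonneg fun t => gaussianPDFReal_nonneg _ _ _
  · exact Integrable.fintype_prod fun i => (integrable_gaussianPDFReal _ _).restrict
  · exact Filter.Eventually.of_forall fun y => (gd_pos m hv y).le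

lemma lintegral_gd {n : ℕ} (m : Fin n → ℝ) {v : ℝ≥0} (hv : v ≠ 0) :
    ∫⁻ y, ENNReal.ofReal (gd m v y) = 1 := by
  have := congrArg (fun M => M Set.univ) (pi_gaussian_eq m hv)
  simpa using this.symm

lemma log_gd {n : ℕ} (m : Fin n → ℝ) {v : ℝ≥0} (hv : v ≠ 0) (y : Fin n → ℝ) :
    Real.log (gd m v y) = - ((n : ℝ) / 2) * Real.log (2 * Real.pi)
      - ((n : ℝ) / 2) * Real.log v - ∑ i, (y i - m i) ^ 2 / (2 * v) := by
  have hv' : (0 : ℝ) < v := by positivity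
  unfold gd
  rw [Real.log_prod (fun i _ => (gaussianPDFReal_pos _ _ _ hv).ne')]
  have : ∀ i, Real.log (gaussianPDFReal (m i) v (y i)) =
      - (1 / 2) * (Real.log (2 * Real.pi) + Real.log v) - (y i - m i) ^ 2 / (2 * v) := by
    intro i
    rw [gaussianPDFReal, Real.log_mul (by positivity) (by positivity), Real.log_inv,
      Real.log_sqrt (by positivity), Real.log_exp, Real.log_mul (by positivity) hv'.ne']
    ring
  simp_rw [this]
  rw [Finset.sum_sub_distrib]
  simp
  ring

instance (n : ℕ) : IsProbabilityMeasure (stdGaussian n) := by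
  unfold stdGaussian; infer_instance

lemma jointLaw_eq (H : Matrix (Fin nr) (Fin nt) ℝ) (μ : Measure (Fin nt → ℝ))
    [IsProbabilityMeasure μ] :
    jointLaw H μ = (μ.prod volume).withDensity
      (fun p => ENNReal.ofReal (gd 0 1 (p.2 - H.mulVec p.1))) := by
  have hH : Continuous (fun x => H.mulVec x) := Continuous.matrix_mulVec continuous_const continuous_id
  have hHm := hH.measurable
  have hg := measurable_gd (0 : Fin nr → ℝ) 1
  have hmap : Measurable (fun p : (Fin nt → ℝ) × (Fin nr → ℝ) => (p.1, H.mulVec p.1 + p.2)) := by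
    fun_prop
  have hs : stdGaussian nr = (volume : Measure (Fin nr → ℝ)).withDensity
      (fun y => ENNReal.ofReal (gd 0 1 y)) := by
    rw [← pi_gaussian_eq 0 one_ne_zero]; rfl
  refine Measure.ext_of_lintegral _ fun F hF => ?_
  have hd : Measurable (fun p : (Fin nt → ℝ) × (Fin nr → ℝ) =>
      ENNReal.ofReal (gd 0 1 (p.2 - H.mulVec p.1))) := by fun_prop
  rw [jointLaw, lintegral_map hF hmap, lintegral_prod _ (by fun_prop),
    lintegral_withDensity_eq_lintegral_mul _ hd hF, lintegral_prod _ (by fun_prop)]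
  refine lintegral_congr fun x => ?_
  rw [hs, lintegral_withDensity_eq_lintegral_mul _ (by fun_prop) (by fun_prop)]
  simp only [Pi.mul_apply]
  rw [← lintegral_add_left_eq_self
    (fun y => ENNReal.ofReal (gd 0 1 (y - H.mulVec x)) * F (x, y)) (H.mulVec x)]
  simp

lemma abs_mulVec_le (H : Matrix (Fin nr) (Fin nt) ℝ) {A : ℝ} {x : Fin nt → ℝ}
    (hx : ∀ k, x k ∈ Set.Icc (0 : ℝ) A) (i : Fin nr) :
    |H.mulVec x i| ≤ ∑ k, |H i k| * A := by
  rw [Matrix.mulVec, dotProduct]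
  refine (Finset.abs_sum_le_sum_abs _ _).trans (Finset.sum_le_sum fun k _ => ?_)
  rw [abs_mul, abs_of_nonneg (hx k).1]
  exact mul_le_mul_of_nonneg_left (hx k).2 (abs_nonneg _)

lemma measurable_mulVec (H : Matrix (Fin nr) (Fin nt) ℝ) :
    Measurable (fun x => H.mulVec x) :=
  (Continuous.matrix_mulVec continuous_const continuous_id).measurable

lemma measurable_mulVec_apply (H : Matrix (Fin nr) (Fin nt) ℝ) (i : Fin nr) :
    Measurable (fun x => H.mulVec x i) :=
  (measurable_pi_apply i).comp (measurable_mulVec H)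

lemma memLp_mulVec (H : Matrix (Fin nr) (Fin nt) ℝ) {A avg : ℝ} {μ : Measure (Fin nt → ℝ)}
    (h : Admissible nt A avg μ) (i : Fin nr) : MemLp (fun x => H.mulVec x i) 2 μ := by
  obtain ⟨hp, hb, -⟩ := h
  refine MemLp.of_bound (measurable_mulVec_apply H i).aestronglyMeasurable (∑ k, |H i k| * A) ?_
  filter_upwards [hb] with x hx using abs_mulVec_le H hx i

lemma var_term_eq (H : Matrix (Fin nr) (Fin nt) ℝ) {A avg : ℝ} {μ : Measure (Fin nt → ℝ)}
    (h : Admissible nt A avg μ) (i : Fin nr) :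
    (∫ x, (H.mulVec x i) ^ 2 ∂μ) - (∫ x, H.mulVec x i ∂μ) ^ 2 =
      ∫ x, (H.mulVec x i - ∫ x, H.mulVec x i ∂μ) ^ 2 ∂μ := by
  have hL := memLp_mulVec H h i
  obtain ⟨hp, hb, -⟩ := h
  have e := variance_eq_sub hL
  rw [variance_eq_integral hL.1.aemeasurable] at e
  exact e.symm

lemma traceCov_nonneg (H : Matrix (Fin nr) (Fin nt) ℝ) {A avg : ℝ} {μ : Measure (Fin nt → ℝ)}
    (h : Admissible nt A avg μ) : 0 ≤ traceCov H μ := by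
  refine Finset.sum_nonneg fun i _ => ?_
  rw [var_term_eq H h i]
  exact integral_nonneg fun x => sq_nonneg _

lemma traceCov_le (H : Matrix (Fin nr) (Fin nt) ℝ) {A avg : ℝ} {μ : Measure (Fin nt → ℝ)}
    (h : Admissible nt A avg μ) : traceCov H μ ≤ ∑ i, (∑ k, |H i k| * A) ^ 2 := by
  refine Finset.sum_le_sum fun i _ => ?_
  have hL := memLp_mulVec H h i
  obtain ⟨hp, hb, -⟩ := h
  have : ∫ x, (H.mulVec x i) ^ 2 ∂μ ≤ ∫ x, (∑ k, |H i k| * A) ^ 2 ∂μ := by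
    refine integral_mono_ae hL.integrable_sq (integrable_const _) ?_
    filter_upwards [hb] with x hx
    exact sq_le_sq' (abs_le.1 (abs_mulVec_le H hx i)).1 (abs_le.1 (abs_mulVec_le H hx i)).2
  simp only [integral_const, probReal_univ, smul_eq_mul, one_mul] at this
  nlinarith [sq_nonneg (∫ x, H.mulVec x i ∂μ)]

lemma memLp_z (n : ℕ) (i : Fin n) : MemLp (fun z : Fin n → ℝ => z i) 2 (stdGaussian n) :=
  (memLp_id_gaussianReal' (μ := 0) (v := 1) 2 (by simp)).comp_measurePreserving
    (measurePreserving_eval (fun _ : Fin n => gaussianReal 0 1) i)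

lemma integral_z (n : ℕ) (i : Fin n) : ∫ z, z i ∂(stdGaussian n) = 0 := by
  unfold stdGaussian
  rw [integral_comp_eval (μ := fun _ : Fin n => gaussianReal 0 1) (i := i) (f := fun t : ℝ => t)
    (by fun_prop)]
  exact integral_id_gaussianReal

lemma integral_z_sq (n : ℕ) (i : Fin n) : ∫ z, (z i) ^ 2 ∂(stdGaussian n) = 1 := by
  unfold stdGaussian
  rw [integral_comp_eval (μ := fun _ : Fin n => gaussianReal 0 1) (i := i)
    (f := fun t : ℝ => t ^ 2) (by fun_prop)]
  have e := variance_eq_sub (memLp_id_gaussianReal' (μ := 0) (v := 1) 2 (by simp))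
  rw [variance_id_gaussianReal] at e
  simpa using e.symm

lemma sum_sq_integral (μ : Measure (Fin nt → ℝ)) [IsProbabilityMeasure μ]
    (w : (Fin nt → ℝ) → ℝ) (hw : MemLp w 2 μ) (i : Fin nr) :
    Integrable (fun p : (Fin nt → ℝ) × (Fin nr → ℝ) => (w p.1 + p.2 i) ^ 2)
      (μ.prod (stdGaussian nr)) ∧
    ∫ p, (w p.1 + p.2 i) ^ 2 ∂(μ.prod (stdGaussian nr)) = (∫ x, (w x) ^ 2 ∂μ) + 1 := by
  have hz := memLp_z nr i
  have i1 : Integrable (fun p : (Fin nt → ℝ) × (Fin nr → ℝ) => (w p.1) ^ 2)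
      (μ.prod (stdGaussian nr)) := hw.integrable_sq.comp_fst _
  have i2 : Integrable (fun p : (Fin nt → ℝ) × (Fin nr → ℝ) => (p.2 i) ^ 2)
      (μ.prod (stdGaussian nr)) := hz.integrable_sq.comp_snd _
  have i3 : Integrable (fun p : (Fin nt → ℝ) × (Fin nr → ℝ) => w p.1 * p.2 i)
      (μ.prod (stdGaussian nr)) :=
    Integrable.mul_prod (hw.integrable (by norm_num)) (hz.integrable (by norm_num))
  have e : (fun p : (Fin nt → ℝ) × (Fin nr → ℝ) => (w p.1 + p.2 i) ^ 2) =
      fun p => ((w p.1) ^ 2 + 2 * (w p.1 * p.2 i)) + (p.2 i) ^ 2 := by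
    funext p; ring
  have i4 : Integrable (fun p : (Fin nt → ℝ) × (Fin nr → ℝ) => 2 * (w p.1 * p.2 i))
      (μ.prod (stdGaussian nr)) := i3.const_mul 2
  have i5 : Integrable (fun p : (Fin nt → ℝ) × (Fin nr → ℝ) =>
      (w p.1) ^ 2 + 2 * (w p.1 * p.2 i)) (μ.prod (stdGaussian nr)) := i1.add i4
  rw [e]
  refine ⟨i5.add i2, ?_⟩
  rw [integral_add i5 i2, integral_add i1 i4, integral_const_mul,
    integral_prod_mul (fun x => w x) (fun z : Fin nr → ℝ => z i), integral_z,
    integral_fun_fst (fun x => w x ^ 2), integral_fun_snd (fun z : Fin nr → ℝ => z i ^ 2),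
    integral_z_sq]
  simp

lemma mutualInfo_le (hnr : 1 ≤ nr) (H : Matrix (Fin nr) (Fin nt) ℝ) {A avg : ℝ}
    {μ : Measure (Fin nt → ℝ)} (h : Admissible nt A avg μ) :
    mutualInfoJoint (jointLaw H μ) ≤
      ((nr : ℝ) / 2) * Real.log (1 + (1 / (nr : ℝ)) * traceCov H μ) := by
  have hn : (0 : ℝ) < nr := by exact_mod_cast hnr
  have hp : IsProbabilityMeasure μ := h.1
  have hT := traceCov_nonneg H h
  set T := traceCov H μ with hTdef
  set m : Fin nr → ℝ := fun i => ∫ x, H.mulVec x i ∂μ with hm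
  have hs1 : 1 ≤ 1 + (1 / (nr : ℝ)) * T := by
    have : 0 ≤ (1 / (nr : ℝ)) * T := by positivity
    linarith
  set s : ℝ≥0 := ⟨1 + (1 / (nr : ℝ)) * T, by linarith⟩ with hs
  have hsv : (s : ℝ) = 1 + (1 / (nr : ℝ)) * T := rfl
  have hspos : (0 : ℝ) < s := by rw [hsv]; linarith
  have hs0 : s ≠ 0 := by
    intro h0; rw [h0] at hspos; simp at hspos
  have hHm := measurable_mulVec H
  have hg := measurable_gd (0 : Fin nr → ℝ) 1
  have hgs := measurable_gd m s
  have hmap : Measurable (fun p : (Fin nt → ℝ) × (Fin nr → ℝ) => (p.1, H.mulVec p.1 + p.2)) := by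
    fun_prop
  have hπp : IsProbabilityMeasure (jointLaw H μ) :=
    Measure.isProbabilityMeasure_map hmap.aemeasurable
  have hfst : (jointLaw H μ).map Prod.fst = μ := by
    rw [jointLaw, Measure.map_map measurable_fst hmap]
    exact (measurePreserving_fst (μ := μ) (ν := stdGaussian nr)).map_eq
  -- the pointwise log-likelihood ratio
  have hlog : ∀ x z, Real.log (gd 0 1 ((H.mulVec x + z) - H.mulVec x) /
      gd m s (H.mulVec x + z)) = ((nr : ℝ) / 2) * Real.log s +
        ((∑ i, ((H.mulVec x i - m i) + z i) ^ 2) / (2 * s) - (∑ i, (0 + z i) ^ 2) / 2) := by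
    intro x z
    rw [Real.log_div (gd_pos _ one_ne_zero _).ne' (gd_pos _ hs0 _).ne',
      log_gd _ one_ne_zero, log_gd _ hs0, Finset.sum_div, Finset.sum_div]
    have e : ∀ i, (H.mulVec x + z) i - m i = (H.mulVec x i - m i) + z i := by
      intro i; simp only [Pi.add_apply]; ring
    simp only [e, add_sub_cancel_left, Pi.zero_apply, NNReal.coe_one, Real.log_one, sub_zero,
      mul_one, zero_add]
    ring
  have hw : ∀ i, MemLp (fun x => H.mulVec x i - m i) 2 μ := fun i =>
    (memLp_mulVec H h i).sub (memLp_const _)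
  have hz : ∀ i : Fin nr, _ := fun i =>
    sum_sq_integral (nr := nr) μ (fun _ => 0) (memLp_const 0) i
  have hy : ∀ i : Fin nr, _ := fun i => sum_sq_integral μ _ (hw i) i
  have I1 : Integrable (fun p : (Fin nt → ℝ) × (Fin nr → ℝ) =>
      (∑ i, ((H.mulVec p.1 i - m i) + p.2 i) ^ 2) / (2 * (s : ℝ))) (μ.prod (stdGaussian nr)) :=
    (integrable_finsetSum _ fun i _ => (hy i).1).div_const _
  have I2 : Integrable (fun p : (Fin nt → ℝ) × (Fin nr → ℝ) =>
      (∑ i, (0 + p.2 i) ^ 2) / (2 : ℝ)) (μ.prod (stdGaussian nr)) :=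
    (integrable_finsetSum _ fun i _ => (hz i).1).div_const _
  have I3 : Integrable (fun p : (Fin nt → ℝ) × (Fin nr → ℝ) =>
      (∑ i, ((H.mulVec p.1 i - m i) + p.2 i) ^ 2) / (2 * (s : ℝ))
        - (∑ i, (0 + p.2 i) ^ 2) / (2 : ℝ)) (μ.prod (stdGaussian nr)) := I1.sub I2
  have hLm : Measurable (fun p : (Fin nt → ℝ) × (Fin nr → ℝ) =>
      Real.log (gd 0 1 (p.2 - H.mulVec p.1) / gd m s p.2)) := by fun_prop
  have hInt : Integrable (fun p : (Fin nt → ℝ) × (Fin nr → ℝ) =>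
      Real.log (gd 0 1 (p.2 - H.mulVec p.1) / gd m s p.2)) (jointLaw H μ) := by
    rw [jointLaw, integrable_map_measure hLm.aestronglyMeasurable hmap.aemeasurable]
    simp only [Function.comp_def, hlog]
    exact (integrable_const _).add I3
  have hVal : ∫ p, Real.log (gd 0 1 (p.2 - H.mulVec p.1) / gd m s p.2) ∂(jointLaw H μ)
      = ((nr : ℝ) / 2) * Real.log (1 + (1 / (nr : ℝ)) * T) := by
    rw [jointLaw, integral_map hmap.aemeasurable hLm.aestronglyMeasurable]
    simp only [hlog]
    rw [integral_add (integrable_const _) I3, integral_sub I1 I2, integral_div, integral_div,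
      integral_finsetSum _ fun i _ => (hy i).1, integral_finsetSum _ fun i _ => (hz i).1]
    simp only [fun i => (hy i).2, fun i => (hz i).2]
    have hsum : ∑ i, ((∫ x, (H.mulVec x i - m i) ^ 2 ∂μ) + 1) = nr * s := by
      rw [Finset.sum_add_distrib, hsv, hTdef, traceCov]
      simp only [hm, var_term_eq H h]
      simp
      field_simp
      ring
    rw [hsum, hsv.symm]
    simp
    field_simp
    ring
  have key := mutualInfo_le_aux μ (volume : Measure (Fin nr → ℝ))
    (fun p => ENNReal.ofReal (gd 0 1 (p.2 - H.mulVec p.1))) (by fun_prop)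
    (fun p => by simpa using gd_pos 0 one_ne_zero _) (fun p => by simp)
    (jointLaw H μ) (jointLaw_eq H μ) hfst
    (fun y => ENNReal.ofReal (gd m s y)) (by fun_prop)
    (fun p => by simpa using gd_pos m hs0 _) (fun p => by simp) (lintegral_gd m hs0).le
  simp only [ENNReal.toReal_ofReal (gd_pos _ one_ne_zero _).le,
    ENNReal.toReal_ofReal (gd_pos _ hs0 _).le] at key
  rw [hVal] at key
  refine key hInt ?_
  have := Real.log_nonneg hs1
  positivity

end MimoOptical

/-- For arbitrary `α > 0`,
`C_H(A, αA) ≤ (nr/2) log(1 + (1/nr) max_{P_X} tr(Cov(HX)))`, the maximum being over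
all admissible input distributions. -/
theorem MimoOptical.capacity_upper_bound_traceCov
    (nt nr : ℕ) (hnr : 1 ≤ nr) (hntnr : nr < nt)
    (H : Matrix (Fin nr) (Fin nt) ℝ) (hrank : H.rank = nr)
    (A α : ℝ) (hA : 0 < A) (hα : 0 < α) :
    MimoOptical.capacity H A (α * A) ≤
      ((nr : ℝ) / 2) * Real.log (1 + (1 / (nr : ℝ)) *
        sSup { t | ∃ μ : Measure (Fin nt → ℝ),
          MimoOptical.Admissible nt A (α * A) μ ∧ t = MimoOptical.traceCov H μ }) := by
  have hadm : MimoOptical.Admissible nt A (α * A) (Measure.dirac 0) := by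
    refine ⟨inferInstance, ?_, ?_⟩
    · rw [ae_dirac_eq]
      simpa using fun _ => hA.le
    · rw [integral_dirac]
      simpa using (mul_pos hα hA).le
  have hn : (0 : ℝ) < nr := by exact_mod_cast hnr
  refine csSup_le ⟨_, _, hadm, rfl⟩ ?_
  rintro c ⟨μ, hμ, rfl⟩
  refine (MimoOptical.mutualInfo_le hnr H hμ).trans ?_
  have hT := MimoOptical.traceCov_nonneg H hμ
  have hle : MimoOptical.traceCov H μ ≤ sSup { t | ∃ μ : Measure (Fin nt → ℝ),
          MimoOptical.Admissible nt A (α * A) μ ∧ t = MimoOptical.traceCov H μ } := by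
    refine le_csSup ⟨∑ i, (∑ k, |H i k| * A) ^ 2, ?_⟩ ⟨μ, hμ, rfl⟩
    rintro t ⟨ν, hν, rfl⟩
    exact MimoOptical.traceCov_le H hν
  gcongr
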